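/- For an h-normal N-linear connection of Cartan type, the second-Bianchi-type identity (identity 24 of the Bianchi theorem) holds: the cyclic sum over (i,j,k) of { R^l_pij|k + R^(f)_(r)ij P^l(r)_pk(f) } vanishes, where R^l_pij is the spatial curvature d-tensor, R^(f)_(r)ij = δN2^(f)_(r)i/δx^j − δN2^(f)_(r)j/δx^i, and P^l(r)_pk(f) = ∂H^l_pk/∂p_r^f − C^l(r)_p(f)|k + C^l(s)_p(e) P^(e)(r)_(s)k(f) with P^(e)(r)_(s)k(f) = ∂N2^(e)_(s)k/∂p_r^f + δ^e_f H^r_sk. -/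

import Mathlib

noncomputable section

/-- The dual 1-jet space `E* = ℝ^m × ℝ^n × ℝ^(n×m)`, with coordinates
`(t^a, x^i, p_i^a)`. -/
abbrev Es (m n : ℕ) : Type := (Fin m → ℝ) × (Fin n → ℝ) × (Fin n → Fin m → ℝ)

variable {m n : ℕ}

/-- Kronecker delta. -/
def kd {α : Type*} [DecidableEq α] (a b : α) : ℝ := if a = b then 1 else 0

/-- Partial derivative `∂/∂t^a` on `E*`. -/
def pt (a : Fin m) (F : Es m n → ℝ) (u : Es m n) : ℝ :=
  fderiv ℝ F u (Pi.single a 1, 0, 0)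

/-- Partial derivative `∂/∂x^i` on `E*`. -/
def px (i : Fin n) (F : Es m n → ℝ) (u : Es m n) : ℝ :=
  fderiv ℝ F u (0, Pi.single i 1, 0)

/-- Partial derivative `∂/∂p_i^a` on `E*`. -/
def pp (i : Fin n) (a : Fin m) (F : Es m n → ℝ) (u : Es m n) : ℝ :=
  fderiv ℝ F u (0, 0, Pi.single i (Pi.single a 1))

/-- Adapted derivative `δ/δt^a = ∂/∂t^a - N1^(b)_(j)a ∂/∂p_j^b` of the
nonlinear connection `N = (N1, N2)`; `N1 b j a` stands for `N1^(b)_(j)a`. -/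
def dt (N1 : Fin m → Fin n → Fin m → Es m n → ℝ) (a : Fin m) (F : Es m n → ℝ)
    (u : Es m n) : ℝ :=
  pt a F u - ∑ b, ∑ j, N1 b j a u * pp j b F u

/-- Adapted derivative `δ/δx^i = ∂/∂x^i - N2^(b)_(j)i ∂/∂p_j^b` of the
nonlinear connection `N = (N1, N2)`; `N2 b j i` stands for `N2^(b)_(j)i`. -/
def dx (N2 : Fin m → Fin n → Fin n → Es m n → ℝ) (i : Fin n) (F : Es m n → ℝ)
    (u : Es m n) : ℝ :=
  px i F u - ∑ b, ∑ j, N2 b j i u * pp j b F u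

/-- Partial derivative `∂/∂t^c` on the temporal factor `ℝ^m`. -/
def ptm (c : Fin m) (f : (Fin m → ℝ) → ℝ) (t : Fin m → ℝ) : ℝ :=
  fderiv ℝ f t (Pi.single c 1)

/-- Partial derivative `∂/∂x^k` on the spatial factor `ℝ^n`. -/
def pxn (k : Fin n) (f : (Fin n → ℝ) → ℝ) (x : Fin n → ℝ) : ℝ :=
  fderiv ℝ f x (Pi.single k 1)

/-! ### Christoffel symbols and their curvatures -/

/-- The Christoffel symbols of a (semi-Riemannian) metric `g` with inverse `ginv`
on `ℝ^k`: `γ^a_bc = (1/2) g^{ad} (∂g_db/∂t^c + ∂g_dc/∂t^b - ∂g_bc/∂t^d)`. -/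
def christoffel {k : ℕ} (g ginv : Fin k → Fin k → (Fin k → ℝ) → ℝ)
    (a b c : Fin k) (t : Fin k → ℝ) : ℝ :=
  (1 / 2) * ∑ d, ginv a d t *
    (ptm c (g d b) t + ptm b (g d c) t - ptm d (g b c) t)

/-- The curvature tensor of a family of Christoffel symbols `γ` on `ℝ^k`:
`γ^l_iab = ∂γ^l_ia/∂t^b - ∂γ^l_ib/∂t^a + γ^e_ia γ^l_eb - γ^e_ib γ^l_ea`. -/
def christoffelCurv {k : ℕ} (γ : Fin k → Fin k → Fin k → (Fin k → ℝ) → ℝ)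
    (l i a b : Fin k) (t : Fin k → ℝ) : ℝ :=
  ptm b (γ l i a) t - ptm a (γ l i b) t +
    ∑ e, (γ e i a t * γ l e b t - γ e i b t * γ l e a t)

/-! ### Torsion and curvature d-tensors of an h-normal N-linear connection
`(χ^a_bc, A^i_jc, H^i_jk, C^i(k)_j(c))` on `E*`.  Throughout, `A i j c` stands
for `A^i_jc`, `H i j k` for `H^i_jk` and `C i k j c` for `C^i(k)_j(c)`. -/

section Connection

variable (N1 : Fin m → Fin n → Fin m → Es m n → ℝ)
variable (N2 : Fin m → Fin n → Fin n → Es m n → ℝ)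
variable (χ : Fin m → Fin m → Fin m → (Fin m → ℝ) → ℝ)
variable (A : Fin n → Fin n → Fin m → Es m n → ℝ)
variable (H : Fin n → Fin n → Fin n → Es m n → ℝ)
variable (C : Fin n → Fin n → Fin n → Fin m → Es m n → ℝ)

/-- Torsion `R^(f)_(r)ab = δN1^(f)_(r)a/δt^b - δN1^(f)_(r)b/δt^a`. -/
def RR1 (f : Fin m) (r : Fin n) (a b : Fin m) (u : Es m n) : ℝ :=
  dt N1 b (N1 f r a) u - dt N1 a (N1 f r b) u

/-- Torsion `R^(f)_(r)aj = δN1^(f)_(r)a/δx^j - δN2^(f)_(r)j/δt^a`. -/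
def RRmix (f : Fin m) (r : Fin n) (a : Fin m) (j : Fin n) (u : Es m n) : ℝ :=
  dx N2 j (N1 f r a) u - dt N1 a (N2 f r j) u

/-- Torsion `R^(f)_(r)ij = δN2^(f)_(r)i/δx^j - δN2^(f)_(r)j/δx^i`. -/
def RR2 (f : Fin m) (r i j : Fin n) (u : Es m n) : ℝ :=
  dx N2 j (N2 f r i) u - dx N2 i (N2 f r j) u

/-- Torsion `P^(f)(j)_(r)a(b) = ∂N1^(f)_(r)a/∂p_j^b + δ^f_b A^j_ra - δ^j_r χ^f_ba`. -/
def Ptor1 (f : Fin m) (j : Fin n) (r : Fin n) (a b : Fin m) (u : Es m n) : ℝ :=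
  pp j b (N1 f r a) u + kd f b * A j r a u - kd j r * χ f b a u.1

/-- Torsion `P^(f)(j)_(r)i(b) = ∂N2^(f)_(r)i/∂p_j^b + δ^f_b H^j_ri`. -/
def Ptor2 (f : Fin m) (j r i : Fin n) (b : Fin m) (u : Es m n) : ℝ :=
  pp j b (N2 f r i) u + kd f b * H j r i u

/-- Torsion `S^(f)(j)(k)_(r)(b)(c) = -(δ^f_b C^j(k)_r(c) - δ^f_c C^k(j)_r(b))`. -/
def Stor (f : Fin m) (j k r : Fin n) (b c : Fin m) (u : Es m n) : ℝ :=
  -(kd f b * C j k r c u - kd f c * C k j r b u)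

/-- The `T`-horizontal covariant derivative `C^l(k)_i(c)/b` of `C`. -/
def CcovT (l k i : Fin n) (c : Fin m) (b : Fin m) (u : Es m n) : ℝ :=
  dt N1 b (C l k i c) u + ∑ s, C s k i c u * A l s b u -
    ∑ s, C l k s c u * A s i b u + ∑ s, C l s i c u * A k s b u -
    ∑ f, C l k i f u * χ f c b u.1

/-- The `M`-horizontal covariant derivative
`C^l(k)_i(c)|j = δC^l(k)_i(c)/δx^j + C^s(k)_i(c) H^l_sj - C^l(k)_s(c) H^s_ij
+ C^l(s)_i(c) H^k_sj` of `C`. -/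
def CcovX (l k i : Fin n) (c : Fin m) (j : Fin n) (u : Es m n) : ℝ :=
  dx N2 j (C l k i c) u + ∑ s, C s k i c u * H l s j u -
    ∑ s, C l k s c u * H s i j u + ∑ s, C l s i c u * H k s j u

/-- Curvature `R^l_ibc = δA^l_ib/δt^c - δA^l_ic/δt^b + A^r_ib A^l_rc
- A^r_ic A^l_rb + C^l(r)_i(f) R^(f)_(r)bc`. -/
def curvT (l i : Fin n) (b c : Fin m) (u : Es m n) : ℝ :=
  dt N1 c (A l i b) u - dt N1 b (A l i c) u +
    ∑ r, (A r i b u * A l r c u - A r i c u * A l r b u) +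
    ∑ r, ∑ f, C l r i f u * RR1 N1 f r b c u

/-- Curvature `R^l_ibk = δA^l_ib/δx^k - δH^l_ik/δt^b + A^r_ib H^l_rk
- H^r_ik A^l_rb + C^l(r)_i(f) R^(f)_(r)bk`. -/
def curvMix (l i : Fin n) (b : Fin m) (k : Fin n) (u : Es m n) : ℝ :=
  dx N2 k (A l i b) u - dt N1 b (H l i k) u +
    ∑ r, (A r i b u * H l r k u - H r i k u * A l r b u) +
    ∑ r, ∑ f, C l r i f u * RRmix N1 N2 f r b k u

/-- Curvature `R^l_ijk = δH^l_ij/δx^k - δH^l_ik/δx^j + H^r_ij H^l_rk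
- H^r_ik H^l_rj + C^l(r)_i(f) R^(f)_(r)jk`. -/
def curvH (l i j k : Fin n) (u : Es m n) : ℝ :=
  dx N2 k (H l i j) u - dx N2 j (H l i k) u +
    ∑ r, (H r i j u * H l r k u - H r i k u * H l r j u) +
    ∑ r, ∑ f, C l r i f u * RR2 N2 f r j k u

/-- Curvature `P^l(k)_ib(c) = ∂A^l_ib/∂p_k^c - C^l(k)_i(c)/b
+ C^l(r)_i(f) P^(f)(k)_(r)b(c)`. -/
def curvP1 (l i : Fin n) (b : Fin m) (k : Fin n) (c : Fin m) (u : Es m n) : ℝ :=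
  pp k c (A l i b) u - CcovT N1 χ A C l k i c b u +
    ∑ r, ∑ f, C l r i f u * Ptor1 N1 χ A f k r b c u

/-- Curvature `P^l(k)_ij(c) = ∂H^l_ij/∂p_k^c - C^l(k)_i(c)|j
+ C^l(r)_i(f) P^(f)(k)_(r)j(c)`. -/
def curvP2 (l i j k : Fin n) (c : Fin m) (u : Es m n) : ℝ :=
  pp k c (H l i j) u - CcovX N2 H C l k i c j u +
    ∑ r, ∑ f, C l r i f u * Ptor2 N2 H f k r j c u

/-- Curvature `S^l(j)(k)_i(b)(c) = ∂C^l(j)_i(b)/∂p_k^c - ∂C^l(k)_i(c)/∂p_j^b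
+ C^r(j)_i(b) C^l(k)_r(c) - C^r(k)_i(c) C^l(j)_r(b)`. -/
def curvS (l j k i : Fin n) (b c : Fin m) (u : Es m n) : ℝ :=
  pp k c (C l j i b) u - pp j b (C l k i c) u +
    ∑ r, (C r j i b u * C l k r c u - C r k i c u * C l j r b u)

end Connection

section Bianchi18

variable (N2 : Fin m → Fin n → Fin n → Es m n → ℝ)
variable (H : Fin n → Fin n → Fin n → Es m n → ℝ)
variable (C : Fin n → Fin n → Fin n → Fin m → Es m n → ℝ)

/-- `M`-horizontal covariant derivative of the spatial curvature:
`R^l_pij|k = δR^l_pij/δx^k + R^r_pij H^l_rk - R^l_rij H^r_pk - R^l_prj H^r_ik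
- R^l_pir H^r_jk`. -/
def curvHcov (l p i j k : Fin n) (u : Es m n) : ℝ :=
  dx N2 k (fun v => curvH N2 H C l p i j v) u +
    ∑ r, curvH N2 H C r p i j u * H l r k u -
    ∑ r, curvH N2 H C l r i j u * H r p k u -
    ∑ r, curvH N2 H C l p r j u * H r i k u -
    ∑ r, curvH N2 H C l p i r u * H r j k u

end Bianchi18


/-! ### Helper lemmas -/

section Helpers

/-- The adapted vector field as an honest vector field. -/
def hX (N2 : Fin m → Fin n → Fin n → Es m n → ℝ) (i : Fin n) (u : Es m n) : Es m n :=
  (0, Pi.single i 1, fun j b => - N2 b j i u)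

lemma fderiv_vert (F : Es m n → ℝ) (u : Es m n) (M : Fin n → Fin m → ℝ) :
    fderiv ℝ F u (0, 0, M) = ∑ b, ∑ j, M j b * pp j b F u := by
  have hM : ((0, 0, M) : Es m n)
      = ∑ b, ∑ j, M j b • ((0, 0, Pi.single j (Pi.single b 1)) : Es m n) := by
    refine Prod.ext ?_ (Prod.ext ?_ ?_)
    · simp [Prod.fst_sum]
    · simp [Prod.fst_sum, Prod.snd_sum]
    · funext j b
      simp [Prod.snd_sum, Finset.sum_apply, Pi.single_apply]
  rw [hM]
  simp only [map_sum, map_smul, pp, smul_eq_mul]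

lemma dx_eq (N2 : Fin m → Fin n → Fin n → Es m n → ℝ) (i : Fin n) (F : Es m n → ℝ)
    (u : Es m n) : dx N2 i F u = fderiv ℝ F u (hX N2 i u) := by
  have : hX N2 i u = ((0, Pi.single i 1, 0) : Es m n)
      + (0, 0, fun j b => - N2 b j i u) := by
    simp [hX]
  rw [this, map_add, fderiv_vert]
  simp [dx, px, sub_eq_add_neg]

variable {N2 : Fin m → Fin n → Fin n → Es m n → ℝ}

lemma hX_smooth (hN2 : ∀ e r i, ContDiff ℝ (⊤ : ℕ∞) (N2 e r i)) (i : Fin n) :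
    ContDiff ℝ (⊤ : ℕ∞) (hX N2 i) := by
  unfold hX
  refine contDiff_const.prodMk (contDiff_const.prodMk ?_)
  exact contDiff_pi.2 fun j => contDiff_pi.2 fun b => (hN2 b j i).neg

lemma hX_fderiv (hN2 : ∀ e r i, ContDiff ℝ (⊤ : ℕ∞) (N2 e r i)) (i : Fin n) (u w : Es m n) :
    fderiv ℝ (hX N2 i) u w = (0, 0, fun j b => - fderiv ℝ (N2 b j i) u w) := by
  have h3 : HasFDerivAt (fun u : Es m n => (fun j b => - N2 b j i u : Fin n → Fin m → ℝ))
      (ContinuousLinearMap.pi fun j => ContinuousLinearMap.pi fun b =>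
        - fderiv ℝ (N2 b j i) u) u :=
    hasFDerivAt_pi.2 fun j => hasFDerivAt_pi.2 fun b =>
      (((hN2 b j i).differentiable (by simp)) u).hasFDerivAt.neg
  have h := (hasFDerivAt_const (0 : Fin m → ℝ) u).prodMk
    ((hasFDerivAt_const (Pi.single i 1 : Fin n → ℝ) u).prodMk h3)
  have h' : fderiv ℝ (hX N2 i) u = _ := h.fderiv
  rw [h']
  rfl

lemma dx_smooth (hN2 : ∀ e r i, ContDiff ℝ (⊤ : ℕ∞) (N2 e r i)) (i : Fin n)
    {F : Es m n → ℝ} (hF : ContDiff ℝ (⊤ : ℕ∞) F) : ContDiff ℝ (⊤ : ℕ∞) (dx N2 i F) := by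
  have : dx N2 i F = fun u => fderiv ℝ F u (hX N2 i u) := funext fun u => dx_eq N2 i F u
  rw [this]
  exact (hF.fderiv_right (by simp)).clm_apply (hX_smooth hN2 i)

lemma dx_dx (hN2 : ∀ e r i, ContDiff ℝ (⊤ : ℕ∞) (N2 e r i)) (i j : Fin n)
    {F : Es m n → ℝ} (hF : ContDiff ℝ (⊤ : ℕ∞) F) (u : Es m n) :
    dx N2 j (dx N2 i F) u = fderiv ℝ (fderiv ℝ F) u (hX N2 j u) (hX N2 i u)
      - ∑ f, ∑ r, dx N2 j (N2 f r i) u * pp r f F u := by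
  have e : dx N2 i F = fun u => fderiv ℝ F u (hX N2 i u) := funext fun u => dx_eq N2 i F u
  have h1 : ContDiff ℝ (⊤ : ℕ∞) (fderiv ℝ F) := hF.fderiv_right (by simp)
  have h := ((h1.differentiable (by simp)) u).hasFDerivAt.clm_apply
    (((hX_smooth hN2 i).differentiable (by simp)) u).hasFDerivAt
  rw [dx_eq, e, h.fderiv]
  simp only [add_apply, ContinuousLinearMap.comp_apply,
    ContinuousLinearMap.flip_apply, hX_fderiv hN2, fderiv_vert, dx_eq]
  simp
  ring

lemma dx_comm (hN2 : ∀ e r i, ContDiff ℝ (⊤ : ℕ∞) (N2 e r i)) (j k : Fin n)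
    {F : Es m n → ℝ} (hF : ContDiff ℝ (⊤ : ℕ∞) F) (u : Es m n) :
    dx N2 j (dx N2 k F) u - dx N2 k (dx N2 j F) u
      = ∑ f, ∑ r, RR2 N2 f r j k u * pp r f F u := by
  have hs : IsSymmSndFDerivAt ℝ F u :=
    (hF.contDiffAt).isSymmSndFDerivAt (by
      simp only [minSmoothness_of_isRCLikeNormedField]; exact WithTop.coe_le_coe.2 (le_top : (2 : ℕ∞) ≤ ⊤))
  rw [dx_dx hN2 _ _ hF, dx_dx hN2 _ _ hF, hs.eq (hX N2 j u) (hX N2 k u)]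
  simp only [RR2, sub_mul, Finset.sum_sub_distrib]
  ring

lemma dx_add {F G : Es m n → ℝ} (k : Fin n) (u : Es m n) (hF : ContDiff ℝ (⊤ : ℕ∞) F)
    (hG : ContDiff ℝ (⊤ : ℕ∞) G) :
    dx N2 k (fun v => F v + G v) u = dx N2 k F u + dx N2 k G u := by
  simp only [dx_eq]
  rw [fderiv_fun_add (hF.differentiable (by simp) u) (hG.differentiable (by simp) u)]
  rfl

lemma dx_sub {F G : Es m n → ℝ} (k : Fin n) (u : Es m n) (hF : ContDiff ℝ (⊤ : ℕ∞) F)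
    (hG : ContDiff ℝ (⊤ : ℕ∞) G) :
    dx N2 k (fun v => F v - G v) u = dx N2 k F u - dx N2 k G u := by
  simp only [dx_eq]
  rw [fderiv_fun_sub (hF.differentiable (by simp) u) (hG.differentiable (by simp) u)]
  rfl

lemma dx_mul {F G : Es m n → ℝ} (k : Fin n) (u : Es m n) (hF : ContDiff ℝ (⊤ : ℕ∞) F)
    (hG : ContDiff ℝ (⊤ : ℕ∞) G) :
    dx N2 k (fun v => F v * G v) u = dx N2 k F u * G u + F u * dx N2 k G u := by
  simp only [dx_eq]
  rw [fderiv_fun_mul (hF.differentiable (by simp) u) (hG.differentiable (by simp) u)]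
  simp
  ring

lemma dx_sum {ι : Type*} [Fintype ι] {F : ι → Es m n → ℝ} (k : Fin n) (u : Es m n)
    (hF : ∀ x, ContDiff ℝ (⊤ : ℕ∞) (F x)) :
    dx N2 k (fun v => ∑ x, F x v) u = ∑ x, dx N2 k (F x) u := by
  simp only [dx_eq]
  rw [fderiv_fun_sum (fun x _ => (hF x).differentiable (by simp) u)]
  simp

lemma RR2_smooth (hN2 : ∀ e r i, ContDiff ℝ (⊤ : ℕ∞) (N2 e r i)) (f : Fin m) (r i j : Fin n) :
    ContDiff ℝ (⊤ : ℕ∞) (RR2 N2 f r i j) :=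
  (dx_smooth hN2 j (hN2 f r i)).sub (dx_smooth hN2 i (hN2 f r j))

/-- The Jacobi-type identity for the nonlinear curvature. -/
lemma RR2_bianchi (hN2 : ∀ e r i, ContDiff ℝ (⊤ : ℕ∞) (N2 e r i)) (e : Fin m) (s i j k : Fin n)
    (u : Es m n) :
    (dx N2 k (RR2 N2 e s i j) u + ∑ f, ∑ r, RR2 N2 f r i j u * pp r f (N2 e s k) u) +
    (dx N2 i (RR2 N2 e s j k) u + ∑ f, ∑ r, RR2 N2 f r j k u * pp r f (N2 e s i) u) +
    (dx N2 j (RR2 N2 e s k i) u + ∑ f, ∑ r, RR2 N2 f r k i u * pp r f (N2 e s j) u) = 0 := by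
  have hd : ∀ i j k, dx N2 k (RR2 N2 e s i j) u
      = dx N2 k (dx N2 j (N2 e s i)) u - dx N2 k (dx N2 i (N2 e s j)) u := fun i j k =>
    dx_sub k u (dx_smooth hN2 j (hN2 e s i)) (dx_smooth hN2 i (hN2 e s j))
  simp only [hd, ← dx_comm hN2 _ _ (hN2 e s _)]
  ring

lemma RR2_anti (f : Fin m) (r i j : Fin n) (u : Es m n) :
    RR2 N2 f r j i u = - RR2 N2 f r i j u := by
  simp [RR2]

variable {H : Fin n → Fin n → Fin n → Es m n → ℝ}
variable {C : Fin n → Fin n → Fin n → Fin m → Es m n → ℝ}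

lemma curvH_anti (l p i j : Fin n) (u : Es m n) :
    curvH N2 H C l p j i u = - curvH N2 H C l p i j u := by
  simp only [curvH, RR2_anti _ _ i j, Finset.sum_sub_distrib, mul_neg, Finset.sum_neg_distrib]
  ring

/-- The part of the curvature that does not involve `C`. -/
def KH (N2 : Fin m → Fin n → Fin n → Es m n → ℝ) (H : Fin n → Fin n → Fin n → Es m n → ℝ)
    (l i j k : Fin n) (u : Es m n) : ℝ :=
  dx N2 k (H l i j) u - dx N2 j (H l i k) u +
    ∑ r, (H r i j u * H l r k u - H r i k u * H l r j u)

lemma curvP2_eq (l p k r : Fin n) (f : Fin m) (u : Es m n) :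
    curvP2 N2 H C l p k r f u = pp r f (H l p k) u - dx N2 k (C l r p f) u
      - ∑ s, C s r p f u * H l s k u + ∑ s, C l r s f u * H s p k u
      + ∑ s, ∑ e, C l s p e u * pp r f (N2 e s k) u := by
  have : ∑ s, ∑ e, C l s p e u * Ptor2 N2 H e r s k f u
      = ∑ s, ∑ e, C l s p e u * pp r f (N2 e s k) u + ∑ s, C l s p f u * H r s k u := by
    rw [← Finset.sum_add_distrib]
    refine Finset.sum_congr rfl fun s _ => ?_
    simp [Ptor2, mul_add, Finset.sum_add_distrib, kd]
  rw [curvP2, this, CcovX]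
  ring

lemma dx_KH (hN2 : ∀ e r i, ContDiff ℝ (⊤ : ℕ∞) (N2 e r i))
    (hHs : ∀ i j k, ContDiff ℝ (⊤ : ℕ∞) (H i j k)) (l p i j k : Fin n) (u : Es m n) :
    dx N2 k (KH N2 H l p i j) u
      = dx N2 k (dx N2 j (H l p i)) u - dx N2 k (dx N2 i (H l p j)) u
      + ∑ r, ((dx N2 k (H r p i) u * H l r j u + H r p i u * dx N2 k (H l r j) u)
        - (dx N2 k (H r p j) u * H l r i u + H r p j u * dx N2 k (H l r i) u)) := by
  unfold KH
  have s1 := fun l p i j => dx_smooth hN2 j (hHs l p i)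
  have s2 : ∀ r, ContDiff ℝ (⊤ : ℕ∞) (fun u => H r p i u * H l r j u) :=
    fun r => (hHs r p i).mul (hHs l r j)
  have s3 : ∀ r, ContDiff ℝ (⊤ : ℕ∞) (fun u => H r p j u * H l r i u) :=
    fun r => (hHs r p j).mul (hHs l r i)
  rw [dx_add k u ((s1 l p i j).sub (s1 l p j i)) (ContDiff.sum fun r _ => (s2 r).sub (s3 r)),
    dx_sub k u (s1 l p i j) (s1 l p j i), dx_sum k u (fun r => (s2 r).sub (s3 r))]
  congr 1
  refine Finset.sum_congr rfl fun r _ => ?_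
  rw [dx_sub k u (s2 r) (s3 r), dx_mul k u (hHs r p i) (hHs l r j),
    dx_mul k u (hHs r p j) (hHs l r i)]

lemma KH_smooth (hN2 : ∀ e r i, ContDiff ℝ (⊤ : ℕ∞) (N2 e r i))
    (hHs : ∀ i j k, ContDiff ℝ (⊤ : ℕ∞) (H i j k)) (l p i j : Fin n) :
    ContDiff ℝ (⊤ : ℕ∞) (KH N2 H l p i j) :=
  ((dx_smooth hN2 j (hHs l p i)).sub (dx_smooth hN2 i (hHs l p j))).add
    (ContDiff.sum fun r _ => ((hHs r p i).mul (hHs l r j)).sub ((hHs r p j).mul (hHs l r i)))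

lemma dx_curvH (hN2 : ∀ e r i, ContDiff ℝ (⊤ : ℕ∞) (N2 e r i))
    (hHs : ∀ i j k, ContDiff ℝ (⊤ : ℕ∞) (H i j k))
    (hCs : ∀ i k j c, ContDiff ℝ (⊤ : ℕ∞) (C i k j c)) (l p i j k : Fin n) (u : Es m n) :
    dx N2 k (fun v => curvH N2 H C l p i j v) u
      = dx N2 k (KH N2 H l p i j) u
      + ∑ r, ∑ f, (dx N2 k (C l r p f) u * RR2 N2 f r i j u
        + C l r p f u * dx N2 k (RR2 N2 f r i j) u) := by
  have s : ∀ r f, ContDiff ℝ (⊤ : ℕ∞) (fun u => C l r p f u * RR2 N2 f r i j u) :=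
    fun r f => (hCs l r p f).mul (RR2_smooth hN2 f r i j)
  have e : (fun v => curvH N2 H C l p i j v)
      = fun v => KH N2 H l p i j v + ∑ r, ∑ f, C l r p f v * RR2 N2 f r i j v := rfl
  rw [e, dx_add k u (KH_smooth hN2 hHs l p i j)
    (ContDiff.sum fun r _ => ContDiff.sum fun f _ => s r f),
    dx_sum k u (fun r => ContDiff.sum fun f _ => s r f)]
  congr 1
  refine Finset.sum_congr rfl fun r _ => ?_
  rw [dx_sum k u (fun f => s r f)]
  refine Finset.sum_congr rfl fun f _ => ?_
  exact dx_mul k u (hCs l r p f) (RR2_smooth hN2 f r i j)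

lemma sum_comm3 {α β γ : Type*} [Fintype α] [Fintype β] [Fintype γ] (g : α → β → γ → ℝ) :
    ∑ s, ∑ r, ∑ f, g s r f = ∑ f, ∑ r, ∑ s, g s r f := by
  rw [Finset.sum_comm]
  calc ∑ r, ∑ s, ∑ f, g s r f = ∑ r, ∑ f, ∑ s, g s r f :=
        Finset.sum_congr rfl fun r _ => Finset.sum_comm
    _ = _ := Finset.sum_comm

lemma sum_comm4 {α β γ ε : Type*} [Fintype α] [Fintype β] [Fintype γ] [Fintype ε]
    (g : α → β → γ → ε → ℝ) :
    ∑ a, ∑ b, ∑ c, ∑ d, g a b c d = ∑ c, ∑ d, ∑ a, ∑ b, g a b c d := by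
  calc ∑ a, ∑ b, ∑ c, ∑ d, g a b c d = ∑ x : α × β, ∑ y : γ × ε, g x.1 x.2 y.1 y.2 := by
        simp only [Fintype.sum_prod_type]
    _ = ∑ y : γ × ε, ∑ x : α × β, g x.1 x.2 y.1 y.2 := Finset.sum_comm
    _ = _ := by simp only [Fintype.sum_prod_type]

lemma one_term (hN2 : ∀ e r i, ContDiff ℝ (⊤ : ℕ∞) (N2 e r i))
    (hHs : ∀ i j k, ContDiff ℝ (⊤ : ℕ∞) (H i j k))
    (hCs : ∀ i k j c, ContDiff ℝ (⊤ : ℕ∞) (C i k j c)) (l p i j k : Fin n) (u : Es m n) :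
    curvHcov N2 H C l p i j k u + ∑ f, ∑ r, RR2 N2 f r i j u * curvP2 N2 H C l p k r f u
      = (dx N2 k (KH N2 H l p i j) u + ∑ r, KH N2 H r p i j u * H l r k u
          - ∑ r, KH N2 H l r i j u * H r p k u
          + ∑ f, ∑ r, RR2 N2 f r i j u * pp r f (H l p k) u)
        + ∑ s, ∑ e, C l s p e u * (dx N2 k (RR2 N2 e s i j) u
          + ∑ f, ∑ r, RR2 N2 f r i j u * pp r f (N2 e s k) u)
        - ∑ r, curvH N2 H C l p r j u * H r i k u
        - ∑ r, curvH N2 H C l p i r u * H r j k u := by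
  have e : ∀ l p, curvH N2 H C l p i j u
      = KH N2 H l p i j u + ∑ r, ∑ f, C l r p f u * RR2 N2 f r i j u := fun _ _ => rfl
  rw [curvHcov, dx_curvH hN2 hHs hCs]
  simp only [e, curvP2_eq]
  have h1 : ∑ s, (∑ r, ∑ f, C s r p f u * RR2 N2 f r i j u) * H l s k u
      = ∑ f, ∑ r, RR2 N2 f r i j u * ∑ s, C s r p f u * H l s k u := by
    simp only [Finset.sum_mul, Finset.mul_sum]
    rw [sum_comm3]
    exact Finset.sum_congr rfl fun f _ => Finset.sum_congr rfl fun r _ =>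
      Finset.sum_congr rfl fun s _ => by ring
  have h2 : ∑ s, (∑ r, ∑ f, C l r s f u * RR2 N2 f r i j u) * H s p k u
      = ∑ f, ∑ r, RR2 N2 f r i j u * ∑ s, C l r s f u * H s p k u := by
    simp only [Finset.sum_mul, Finset.mul_sum]
    rw [sum_comm3]
    exact Finset.sum_congr rfl fun f _ => Finset.sum_congr rfl fun r _ =>
      Finset.sum_congr rfl fun s _ => by ring
  have h3 : ∑ s, ∑ e, C l s p e u * ∑ f, ∑ r, RR2 N2 f r i j u * pp r f (N2 e s k) u
      = ∑ f, ∑ r, RR2 N2 f r i j u * ∑ s, ∑ e, C l s p e u * pp r f (N2 e s k) u := by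
    simp only [Finset.mul_sum]
    rw [sum_comm4]
    exact Finset.sum_congr rfl fun f _ => Finset.sum_congr rfl fun r _ =>
      Finset.sum_congr rfl fun s _ => Finset.sum_congr rfl fun e _ => by ring
  have h4 : ∑ r, ∑ f, dx N2 k (C l r p f) u * RR2 N2 f r i j u
      = ∑ f, ∑ r, RR2 N2 f r i j u * dx N2 k (C l r p f) u := by
    rw [Finset.sum_comm]
    exact Finset.sum_congr rfl fun f _ => Finset.sum_congr rfl fun r _ => by ring
  simp only [add_mul, mul_add, mul_sub, Finset.sum_add_distrib, Finset.sum_sub_distrib, h1, h2,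
    h3, h4]
  ring

/-- The Bianchi identity for the `C`-free part. -/
lemma KH_bianchi (hN2 : ∀ e r i, ContDiff ℝ (⊤ : ℕ∞) (N2 e r i))
    (hHs : ∀ i j k, ContDiff ℝ (⊤ : ℕ∞) (H i j k)) (l p i j k : Fin n) (u : Es m n) :
    (dx N2 k (KH N2 H l p i j) u + ∑ r, KH N2 H r p i j u * H l r k u
          - ∑ r, KH N2 H l r i j u * H r p k u
          + ∑ f, ∑ r, RR2 N2 f r i j u * pp r f (H l p k) u) +
    (dx N2 i (KH N2 H l p j k) u + ∑ r, KH N2 H r p j k u * H l r i u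
          - ∑ r, KH N2 H l r j k u * H r p i u
          + ∑ f, ∑ r, RR2 N2 f r j k u * pp r f (H l p i) u) +
    (dx N2 j (KH N2 H l p k i) u + ∑ r, KH N2 H r p k i u * H l r j u
          - ∑ r, KH N2 H l r k i u * H r p j u
          + ∑ f, ∑ r, RR2 N2 f r k i u * pp r f (H l p j) u) = 0 := by
  let M : Fin n → Matrix (Fin n) (Fin n) ℝ := fun i => Matrix.of fun l p => H l p i u
  let D : Fin n → Fin n → Matrix (Fin n) (Fin n) ℝ :=
    fun k i => Matrix.of fun l p => dx N2 k (H l p i) u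
  have hK : ∀ l p i j, KH N2 H l p i j u
      = (D j i - D i j + (M j * M i - M i * M j)) l p := by
    intro l p i j
    simp [KH, D, M, Matrix.mul_apply, Finset.sum_sub_distrib, mul_comm]
  have h1 : ∀ i j k, ∑ r, KH N2 H r p i j u * H l r k u
      = (M k * (D j i - D i j + (M j * M i - M i * M j))) l p := by
    intro i j k
    rw [Matrix.mul_apply]
    exact Finset.sum_congr rfl fun r _ => by rw [hK, mul_comm]; rfl
  have h2 : ∀ i j k, ∑ r, KH N2 H l r i j u * H r p k u
      = ((D j i - D i j + (M j * M i - M i * M j)) * M k) l p := by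
    intro i j k
    rw [Matrix.mul_apply]
    exact Finset.sum_congr rfl fun r _ => by rw [hK]; rfl
  have h3 : ∀ i j k, dx N2 k (KH N2 H l p i j) u
      = dx N2 k (dx N2 j (H l p i)) u - dx N2 k (dx N2 i (H l p j)) u
        + (M j * D k i + D k j * M i - (M i * D k j + D k i * M j)) l p := by
    intro i j k
    rw [dx_KH hN2 hHs]
    simp [D, M, Matrix.mul_apply, Finset.sum_sub_distrib, Finset.sum_add_distrib, mul_comm]
  have h4 : M k * (D j i - D i j + (M j * M i - M i * M j))
      - (D j i - D i j + (M j * M i - M i * M j)) * M k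
      + (M j * D k i + D k j * M i - (M i * D k j + D k i * M j))
      + (M i * (D k j - D j k + (M k * M j - M j * M k))
      - (D k j - D j k + (M k * M j - M j * M k)) * M i
      + (M k * D i j + D i k * M j - (M j * D i k + D i j * M k)))
      + (M j * (D i k - D k i + (M i * M k - M k * M i))
      - (D i k - D k i + (M i * M k - M k * M i)) * M j
      + (M i * D j k + D j i * M k - (M k * D j i + D j k * M i))) = 0 := by
    noncomm_ring
  have h5 := congrFun (congrFun h4 l) p
  simp only [h1, h2, h3, ← dx_comm hN2 _ _ (hHs l p _)]
  simp only [Matrix.add_apply, Matrix.sub_apply, Matrix.zero_apply] at h5 ⊢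
  linarith

end Helpers

/-- For an `h`-normal `N`-linear connection of Cartan type, the
second-Bianchi-type identity (identity 24) holds: the cyclic sum over `(i,j,k)` of
`{ R^l_pij|k + R^(f)_(r)ij P^l(r)_pk(f) }` vanishes. -/
theorem Bianchi_identity_24 (m n : ℕ) (hm : 1 ≤ m) (hn : 1 ≤ n)
    -- the temporal metric `h`, its inverse, and its Christoffel symbols `χ`
    (h hinv : Fin m → Fin m → (Fin m → ℝ) → ℝ)
    (hsmooth : ∀ a b, ContDiff ℝ (⊤ : ℕ∞) (h a b)) (hinvsmooth : ∀ a b, ContDiff ℝ (⊤ : ℕ∞) (hinv a b))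
    (hsym : ∀ t a b, h a b t = h b a t)
    (hinverse : ∀ t a b, ∑ f, hinv a f t * h f b t = kd a b)
    (χ : Fin m → Fin m → Fin m → (Fin m → ℝ) → ℝ)
    (hχ : ∀ a b c t, χ a b c t = christoffel h hinv a b c t)
    -- the nonlinear connection `N = (N1, N2)`
    (N1 : Fin m → Fin n → Fin m → Es m n → ℝ)
    (N2 : Fin m → Fin n → Fin n → Es m n → ℝ)
    (hN1 : ∀ e r a, ContDiff ℝ (⊤ : ℕ∞) (N1 e r a)) (hN2 : ∀ e r i, ContDiff ℝ (⊤ : ℕ∞) (N2 e r i))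
    -- the remaining components `A^i_jc`, `H^i_jk`, `C^i(k)_j(c)` of the
    -- `h`-normal `N`-linear connection of Cartan type `CDΓ(N)`
    (A : Fin n → Fin n → Fin m → Es m n → ℝ)
    (H : Fin n → Fin n → Fin n → Es m n → ℝ)
    (C : Fin n → Fin n → Fin n → Fin m → Es m n → ℝ)
    (hAs : ∀ i j c, ContDiff ℝ (⊤ : ℕ∞) (A i j c)) (hHs : ∀ i j k, ContDiff ℝ (⊤ : ℕ∞) (H i j k))
    (hCs : ∀ i k j c, ContDiff ℝ (⊤ : ℕ∞) (C i k j c))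
    (hHsym : ∀ i j k (u : Es m n), H i j k u = H i k j u)
    (hCsym : ∀ i k j c (u : Es m n), C i k j c u = C k i j c u)
    : ∀ (u : Es m n) (l p i j k : Fin n),
      (curvHcov N2 H C l p i j k u +
        ∑ f, ∑ r, RR2 N2 f r i j u * curvP2 N2 H C l p k r f u) +
      (curvHcov N2 H C l p j k i u +
        ∑ f, ∑ r, RR2 N2 f r j k u * curvP2 N2 H C l p i r f u) +
      (curvHcov N2 H C l p k i j u +
        ∑ f, ∑ r, RR2 N2 f r k i u * curvP2 N2 H C l p j r f u) = 0 := by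
  intro u l p i j k
  rw [one_term hN2 hHs hCs, one_term hN2 hHs hCs, one_term hN2 hHs hCs]
  have hK := KH_bianchi hN2 hHs l p i j k u
  have hC : ∑ s, ∑ e, C l s p e u * (dx N2 k (RR2 N2 e s i j) u
          + ∑ f, ∑ r, RR2 N2 f r i j u * pp r f (N2 e s k) u)
      + ∑ s, ∑ e, C l s p e u * (dx N2 i (RR2 N2 e s j k) u
          + ∑ f, ∑ r, RR2 N2 f r j k u * pp r f (N2 e s i) u)
      + ∑ s, ∑ e, C l s p e u * (dx N2 j (RR2 N2 e s k i) u
          + ∑ f, ∑ r, RR2 N2 f r k i u * pp r f (N2 e s j) u) = 0 := by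
    simp only [← Finset.sum_add_distrib, ← mul_add]
    refine Finset.sum_eq_zero fun s _ => Finset.sum_eq_zero fun e _ => ?_
    have := RR2_bianchi hN2 e s i j k u
    rw [this, mul_zero]
  have hT : ∀ i j k, ∑ r, curvH N2 H C l p r j u * H r i k u
      = - ∑ r, curvH N2 H C l p j r u * H r k i u := by
    intro i j k
    rw [← Finset.sum_neg_distrib]
    refine Finset.sum_congr rfl fun r _ => ?_
    rw [curvH_anti l p j r, hHsym r i k]
    ring
  rw [hT i j k, hT j k i, hT k i j]
  linarith
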